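/- arXiv:math/0609028 — 2 statements merged into one kernel-verified Lean document; each statement's English description precedes it below -/
import Mathlib

section
/- The value α = √15/5 is the unique positive real number with the following property: there exist real numbers b and c such that the polynomial (X⁴ + 2X²)·(X² + bX + c) − (X + α)⁶ has degree at most 2. Moreover, for α = √15/5 the numbers b and c are uniquely determined, namely b = 6√15/5 and c = 7. Equivalently, assigning all six closed-loop poles of the two-mass-spring plant with a monic second-order controller denominator to a single point −α of multiplicity six forces α = √15/5. -/
open Polynomial

/-- The difference between the closed-loop polynomial and `(X + a)⁶`, as a sum of monomials. -/
theorem closedLoop_sub_pow_eq {R : Type*} [CommRing R] (a b c : R) :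
    (X ^ 4 + 2 * X ^ 2) * (X ^ 2 + C b * X + C c) - (X + C a) ^ 6 =
      C (b - 6 * a) * X ^ 5 + C (c + 2 - 15 * a ^ 2) * X ^ 4 + C (2 * b - 20 * a ^ 3) * X ^ 3
        + (C (2 * c - 15 * a ^ 4) * X ^ 2 + C (-6 * a ^ 5) * X + C (-a ^ 6)) := by
  simp only [C_sub, C_add, C_mul, C_neg, C_pow, C_ofNat]
  ring

/-- The pole placement condition amounts to the vanishing of the coefficients of
`X⁵`, `X⁴` and `X³`. -/
theorem degree_closedLoop_sub_pow_le_two_iff {R : Type*} [CommRing R] (a b c : R) :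
    ((X ^ 4 + 2 * X ^ 2) * (X ^ 2 + C b * X + C c) - (X + C a) ^ 6).degree ≤ 2 ↔
      b = 6 * a ∧ c + 2 = 15 * a ^ 2 ∧ 2 * b = 20 * a ^ 3 := by
  rw [closedLoop_sub_pow_eq]
  constructor
  · intro h
    have hcoeff (n : ℕ) (hn : 2 < n) := coeff_eq_zero_of_degree_lt
      (h.trans_lt (by exact_mod_cast hn : (2 : WithBot ℕ) < n))
    have h5 := hcoeff 5 (by norm_num)
    have h4 := hcoeff 4 (by norm_num)
    have h3 := hcoeff 3 (by norm_num)
    simp only [coeff_add, coeff_C_mul, coeff_X_pow, coeff_X, coeff_C] at h5 h4 h3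
    norm_num at h5 h4 h3
    exact ⟨sub_eq_zero.mp h5, sub_eq_zero.mp h4, sub_eq_zero.mp h3⟩
  · rintro ⟨h5, h4, h3⟩
    rw [sub_eq_zero.mpr h5, sub_eq_zero.mpr h4, sub_eq_zero.mpr h3]
    simp only [C_0, zero_mul, zero_add]
    exact degree_quadratic_le

/-- `α = √15/5` is the unique positive real such that there exist `b c : ℝ` with
`(X⁴ + 2X²)(X² + bX + c) − (X + α)⁶` of degree at most 2 (i.e. all six closed-loop
poles of the two-mass-spring plant can be assigned to `−α` by a proper second-order
controller with monic denominator `X² + bX + c`); moreover for `α = √15/5` the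
numbers `b` and `c` are uniquely determined: `b = 6√15/5` and `c = 7`. -/
theorem two_mass_spring_unique_decay_rate :
    (∀ α : ℝ, 0 < α →
      ((∃ b c : ℝ,
          ((X ^ 4 + 2 * X ^ 2) * (X ^ 2 + C b * X + C c) - (X + C α) ^ 6).degree ≤ 2)
        ↔ α = Real.sqrt 15 / 5))
    ∧ (∀ b c : ℝ,
        ((X ^ 4 + 2 * X ^ 2) * (X ^ 2 + C b * X + C c)
            - (X + C (Real.sqrt 15 / 5)) ^ 6).degree ≤ 2
        → b = 6 * Real.sqrt 15 / 5 ∧ c = 7) := by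
  have hsq : Real.sqrt 15 ^ 2 = 15 := Real.sq_sqrt (by norm_num)
  simp only [degree_closedLoop_sub_pow_le_two_iff]
  refine ⟨fun α hα => ⟨?_, ?_⟩, ?_⟩
  · rintro ⟨b, c, hb, -, h⟩
    have hα2 : α ^ 2 = (Real.sqrt 15 / 5) ^ 2 := by
      apply mul_left_cancel₀ hα.ne'
      rw [div_pow, hsq]
      linarith
    exact (sq_eq_sq₀ hα.le (by positivity)).mp hα2
  · rintro rfl
    refine ⟨6 * (Real.sqrt 15 / 5), 7, rfl, ?_, ?_⟩
    · linear_combination (-3 / 5) * hsq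
    · linear_combination (-4 / 25) * Real.sqrt 15 * hsq
  · rintro b c ⟨hb, hc, -⟩
    constructor
    · linear_combination hb
    · linear_combination hc + (3 / 5) * hsq
end

section
/- Every complex root of the polynomial q(X) = (X⁴ + 2X²)·(X² + (6√15/5)X + 7) − ((43/5)X² − (54√15/125)X − 27/125) has real part equal to −√15/5; in particular the spectral abscissa (maximum of the real parts of the roots) of the closed-loop system obtained from the plant P(s) = 1/(s⁴ + 2s²) with the controller K(s) = ((43/5)s² − (54√15/125)s − 27/125)/(s² + (6√15/5)s + 7) equals −√15/5 ≈ −0.7746, so the closed loop is asymptotically stable. -/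
open Polynomial

/-- The closed-loop characteristic polynomial is the sixth power of `z + √15/5`. -/
lemma eval_closed_loop_charpoly (z : ℂ) :
    ((X ^ 4 + 2 * X ^ 2) * (X ^ 2 + C ((6 * Real.sqrt 15 / 5 : ℝ) : ℂ) * X + C 7)
        - (C ((43 / 5 : ℝ) : ℂ) * X ^ 2 - C ((54 * Real.sqrt 15 / 125 : ℝ) : ℂ) * X
            - C ((27 / 125 : ℝ) : ℂ))).eval z = (z + ((Real.sqrt 15 / 5 : ℝ) : ℂ)) ^ 6 := by
  have h : ((Real.sqrt 15 : ℝ) : ℂ) ^ 2 = 15 := by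
    exact_mod_cast Real.sq_sqrt (show (0 : ℝ) ≤ 15 by norm_num)
  simp only [eval_sub, eval_add, eval_mul, eval_pow, eval_X, eval_C, eval_ofNat]
  push_cast
  generalize ((Real.sqrt 15 : ℝ) : ℂ) = s at h ⊢
  have h3 : s ^ 3 = 15 * s := by linear_combination s * h
  have h4 : s ^ 4 = 225 := by linear_combination (s ^ 2 + 15) * h
  have h5 : s ^ 5 = 225 * s := by linear_combination s * h4
  have h6 : s ^ 6 = 3375 := by linear_combination s ^ 2 * h4 + 225 * h
  ring_nf
  rw [h, h3, h4, h5, h6]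
  ring

/-- Every complex root of
`q(X) = (X⁴ + 2X²)(X² + (6√15/5)X + 7) − ((43/5)X² − (54√15/125)X − 27/125)`
has real part `−√15/5`; moreover `q` has a root, so the spectral abscissa
(the maximum of the real parts of the roots) of the closed loop equals
`−√15/5 < 0` and the closed loop is asymptotically stable. -/
theorem two_mass_spring_spectral_abscissa :
    (∀ z : ℂ,
      ((X ^ 4 + 2 * X ^ 2) * (X ^ 2 + C ((6 * Real.sqrt 15 / 5 : ℝ) : ℂ) * X + C 7)
        - (C ((43 / 5 : ℝ) : ℂ) * X ^ 2 - C ((54 * Real.sqrt 15 / 125 : ℝ) : ℂ) * X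
            - C ((27 / 125 : ℝ) : ℂ))).IsRoot z
      → z.re = -(Real.sqrt 15 / 5))
    ∧ (∃ z : ℂ,
      ((X ^ 4 + 2 * X ^ 2) * (X ^ 2 + C ((6 * Real.sqrt 15 / 5 : ℝ) : ℂ) * X + C 7)
        - (C ((43 / 5 : ℝ) : ℂ) * X ^ 2 - C ((54 * Real.sqrt 15 / 125 : ℝ) : ℂ) * X
            - C ((27 / 125 : ℝ) : ℂ))).IsRoot z)
    ∧ -(Real.sqrt 15 / 5) < 0 := by
  refine ⟨fun z hz => ?_, ⟨-((Real.sqrt 15 / 5 : ℝ) : ℂ), ?_⟩, ?_⟩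
  · rw [IsRoot.def, eval_closed_loop_charpoly] at hz
    rw [eq_neg_of_add_eq_zero_left (eq_zero_of_pow_eq_zero hz), Complex.neg_re,
      Complex.ofReal_re]
  · rw [IsRoot.def, eval_closed_loop_charpoly]
    simp
  · rw [neg_lt_zero]
    positivity
end
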